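/- Let A ∈ GL(2,ℤ) be an Anosov matrix with R(A) ≠ ∅, and suppose A is conjugate in GL(2,ℤ) to a matrix of the form [[x, y], [z, x]] or of the form [[x, y], [w−x, w]]. Then the short exact sequence 1 → Aut₀(E_A) → Aut(E_A) → ℤ/2 → 1 splits: there exists ξ ∈ Aut(E_A) with ξ ∉ Aut₀(E_A) and ξ² = id. Consequently Aut(E_A) is isomorphic to a semidirect product Aut₀(E_A) ⋊ ℤ/2. -/

import Mathlib

open Matrix SemidirectProduct Multiplicative

abbrev GL2Z := GL (Fin 2) ℤ

/-- A matrix in `GL(2,ℤ)` is exceptional if `det = 1` and `|tr| ≤ 2`, or `det = -1` and `tr = 0`. -/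
def IsExceptional (A : GL2Z) : Prop :=
  ((A : Matrix (Fin 2) (Fin 2) ℤ).det = 1 ∧ |(A : Matrix (Fin 2) (Fin 2) ℤ).trace| ≤ 2) ∨
    ((A : Matrix (Fin 2) (Fin 2) ℤ).det = -1 ∧ (A : Matrix (Fin 2) (Fin 2) ℤ).trace = 0)

/-- Anosov = not exceptional. -/
def IsAnosov (A : GL2Z) : Prop := ¬ IsExceptional A

/-- The linear action of a 2×2 integer matrix on `ℤ × ℤ`. -/
def mulVec2 (M : Matrix (Fin 2) (Fin 2) ℤ) (p : ℤ × ℤ) : ℤ × ℤ :=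
  (M 0 0 * p.1 + M 0 1 * p.2, M 1 0 * p.1 + M 1 1 * p.2)

lemma mulVec2_one (p : ℤ × ℤ) : mulVec2 1 p = p := by
  simp [mulVec2, Matrix.one_apply]

lemma mulVec2_mul (M N : Matrix (Fin 2) (Fin 2) ℤ) (p : ℤ × ℤ) :
    mulVec2 (M * N) p = mulVec2 M (mulVec2 N p) := by
  apply Prod.ext <;>
    simp only [mulVec2, Matrix.mul_apply, Fin.sum_univ_two] <;> ring

/-- `mulVec2 M` as an additive monoid homomorphism. -/
def mulVec2Hom (M : Matrix (Fin 2) (Fin 2) ℤ) : (ℤ × ℤ) →+ (ℤ × ℤ) where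
  toFun := mulVec2 M
  map_zero' := by simp [mulVec2]
  map_add' p q := by
    apply Prod.ext <;> simp only [mulVec2, Prod.fst_add, Prod.snd_add] <;> ring

/-- The additive automorphism of `ℤ × ℤ` given by an element of `GL(2,ℤ)`. -/
def glAddAut (A : GL2Z) : AddAut (ℤ × ℤ) where
  toFun := mulVec2 (A : Matrix (Fin 2) (Fin 2) ℤ)
  invFun := mulVec2 ((A⁻¹ : GL2Z) : Matrix (Fin 2) (Fin 2) ℤ)
  left_inv p := by
    rw [← mulVec2_mul]
    rw [show ((A⁻¹ : GL2Z) : Matrix (Fin 2) (Fin 2) ℤ) * (A : Matrix (Fin 2) (Fin 2) ℤ) = 1 from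
      A.inv_mul]
    exact mulVec2_one p
  right_inv p := by
    rw [← mulVec2_mul]
    rw [show (A : Matrix (Fin 2) (Fin 2) ℤ) * ((A⁻¹ : GL2Z) : Matrix (Fin 2) (Fin 2) ℤ) = 1 from
      A.mul_inv]
    exact mulVec2_one p
  map_add' := (mulVec2Hom (A : Matrix (Fin 2) (Fin 2) ℤ)).map_add

/-- The multiplicative automorphism of `Multiplicative (ℤ × ℤ)` given by an element of
`GL(2,ℤ)`. -/
def glMulAut (A : GL2Z) : MulAut (Multiplicative (ℤ × ℤ)) :=
  AddEquiv.toMultiplicative (glAddAut A)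

/-- The action of `ℤ` on `ℤ × ℤ` in which `1` acts by the matrix `A`. -/
def EAphi (A : GL2Z) : Multiplicative ℤ →* MulAut (Multiplicative (ℤ × ℤ)) :=
  zpowersHom _ (glMulAut A)

/-- `E_A = (ℤ × ℤ) ⋊ ℤ`, where `1 : ℤ` acts by the matrix `A`. -/
abbrev EA (A : GL2Z) : Type :=
  Multiplicative (ℤ × ℤ) ⋊[EAphi A] Multiplicative ℤ

/-- The canonical subgroup `ℤ × ℤ` of `E_A`. -/
def EAsub (A : GL2Z) : Subgroup (EA A) :=
  (SemidirectProduct.inl : Multiplicative (ℤ × ℤ) →* EA A).range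

/-- The subgroup of `Aut(E_A)` of automorphisms mapping the canonical `ℤ × ℤ` onto itself and
inducing the identity on the quotient `ℤ` (the quotient map being `rightHom`). -/
def Aut₀ (A : GL2Z) : Subgroup (MulAut (EA A)) where
  carrier := {e | (EAsub A).map e.toMonoidHom = EAsub A ∧
    ∀ g : EA A, rightHom (e g) = rightHom g}
  one_mem' := by
    constructor
    · have : ((1 : MulAut (EA A)).toMonoidHom) = MonoidHom.id (EA A) := rfl
      rw [this, Subgroup.map_id]
    · intro g; rfl
  mul_mem' := by
    intro a b ha hb
    constructor
    · have : ((a * b : MulAut (EA A)).toMonoidHom) = a.toMonoidHom.comp b.toMonoidHom := rfl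
      rw [this, ← Subgroup.map_map, hb.1, ha.1]
    · intro g
      have : (a * b : MulAut (EA A)) g = a (b g) := rfl
      rw [this, ha.2, hb.2]
  inv_mem' := by
    intro a ha
    have hcomp : (a⁻¹ : MulAut (EA A)).toMonoidHom.comp a.toMonoidHom = MonoidHom.id (EA A) := by
      refine MonoidHom.ext fun x => ?_
      show (a⁻¹ : MulAut (EA A)) (a x) = x
      simp
    constructor
    · conv_lhs => rw [← ha.1]
      rw [Subgroup.map_map, hcomp, Subgroup.map_id]
    · intro g
      have := ha.2 ((a⁻¹ : MulAut (EA A)) g)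
      have h2 : a ((a⁻¹ : MulAut (EA A)) g) = g := by simp
      rw [h2] at this
      exact this.symm

/-- A subgroup of index two whose complement contains an involution is the kernel factor of a
semidirect product with `ℤ/2`. -/
lemma Subgroup.exists_mulEquiv_semidirectProduct_zmod_two {G : Type*} [Group G] (N : Subgroup G)
    {ξ : G} (hξ : ξ ∉ N) (hξ2 : ξ * ξ = 1) (hN : ∀ g, ξ * g ∈ N ∨ g ∈ N) :
    ∃ ψ : Multiplicative (ZMod 2) →* MulAut N,
      Nonempty (G ≃* N ⋊[ψ] Multiplicative (ZMod 2)) := by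
  have hnormal : N.Normal := Subgroup.normal_of_index_eq_two
    (Subgroup.index_eq_two_iff_exists_notMem_and'.2 ⟨ξ, hξ, hN⟩)
  have hpow (m : ℤ) : ξ ^ (2 * m) = 1 := by
    rw [_root_.zpow_mul, zpow_ofNat, pow_two, hξ2, _root_.one_zpow]
  have hord : orderOf ξ = 2 := by
    refine orderOf_eq_prime (by rw [pow_two, hξ2]) ?_
    rintro rfl
    exact hξ N.one_mem
  have hcompl : N.IsComplement' (Subgroup.zpowers ξ) := by
    refine Subgroup.isComplement'_of_disjoint_and_mul_eq_univ ?_ ?_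
    · rw [Subgroup.disjoint_def]
      rintro x hx ⟨k, rfl⟩
      rcases Int.even_or_odd' k with ⟨m, rfl | rfl⟩
      · exact hpow m
      · refine absurd ?_ hξ
        have : ξ ^ (2 * m + 1) = ξ := by rw [_root_.zpow_add, hpow, one_mul, zpow_one]
        exact this ▸ hx
    · refine Set.eq_univ_of_forall fun g => ?_
      rw [Set.mem_mul]
      rcases hN g with h | h
      · refine ⟨g * ξ, hnormal.mem_comm h, ξ, Subgroup.mem_zpowers ξ, ?_⟩
        rw [mul_assoc, hξ2, mul_one]
      · exact ⟨g, h, 1, one_mem _, mul_one g⟩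
  have e : Subgroup.zpowers ξ ≃* Multiplicative (ZMod 2) :=
    mulEquivOfPrimeCardEq (p := 2) (by rw [Nat.card_zpowers, hord]) (by simp)
  exact ⟨_, ⟨(SemidirectProduct.mulEquivSubgroup hcompl).symm.trans
    (SemidirectProduct.congr' (MulEquiv.refl N) e)⟩⟩

lemma glMulAut_mul (A B : GL2Z) : glMulAut (A * B) = glMulAut A * glMulAut B :=
  MulEquiv.ext fun p => congrArg ofAdd (mulVec2_mul A.1 B.1 p.toAdd)

/-- `glMulAut` as a group homomorphism. -/
def glMulAutHom : GL2Z →* MulAut (Multiplicative (ℤ × ℤ)) :=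
  MonoidHom.mk' glMulAut glMulAut_mul

lemma EAphi_apply (A : GL2Z) (n : Multiplicative ℤ) :
    EAphi A n = glMulAut A ^ n.toAdd := rfl

/-- The automorphism `(v, n) ↦ (Bv, -n)` of `E_A` when `B` conjugates `A` to `A⁻¹`. -/
def reversal {A B : GL2Z} (h : B * A * B⁻¹ = A⁻¹) : MulAut (EA A) :=
  SemidirectProduct.congr (glMulAut B) (MulEquiv.inv (Multiplicative ℤ)) fun n => by
    have hs : SemiconjBy B A A⁻¹ := by
      rw [SemiconjBy, ← h, inv_mul_cancel_right]
    have hs' : SemiconjBy (glMulAut B) (glMulAut A) (glMulAut A)⁻¹ := by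
      have := hs.map glMulAutHom
      rwa [map_inv] at this
    have hk := (hs'.zpow_right n.toAdd).eq
    rw [_root_.inv_zpow'] at hk
    exact hk

lemma reversal_mul_self {A B : GL2Z} (h : B * A * B⁻¹ = A⁻¹) (hB : B * B = 1) :
    reversal h * reversal h = 1 := by
  have hB' : glMulAut B * glMulAut B = 1 := by
    rw [← glMulAut_mul, hB]; exact map_one glMulAutHom
  refine MulEquiv.ext fun g => SemidirectProduct.ext ?_ ?_
  · exact DFunLike.congr_fun hB' g.left
  · exact inv_inv g.right

lemma rightHom_reversal {A B : GL2Z} (h : B * A * B⁻¹ = A⁻¹) (g : EA A) :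
    rightHom (reversal h g) = (rightHom g)⁻¹ := rfl

lemma reversal_notMem_Aut₀ {A B : GL2Z} (h : B * A * B⁻¹ = A⁻¹) : reversal h ∉ Aut₀ A := by
  intro hmem
  have := hmem.2 (inr (ofAdd 1))
  rw [rightHom_reversal, rightHom_inr] at this
  exact absurd (congrArg toAdd this) (by decide)

/-- An Anosov matrix conjugate to its inverse has determinant one. -/
lemma IsAnosov.det_eq_one {A B : GL2Z} (hA : IsAnosov A) (h : B * A * B⁻¹ = A⁻¹) :
    (A : Matrix (Fin 2) (Fin 2) ℤ).det = 1 := by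
  rcases Int.isUnit_iff.1 ((Matrix.isUnit_iff_isUnit_det _).1 A.isUnit) with hd | hd
  · exact hd
  · refine absurd (Or.inr ⟨hd, ?_⟩) hA
    have htr : (A⁻¹ : GL2Z).1.trace = A.1.trace := by
      rw [← h]
      simp only [Units.val_mul]
      rw [Matrix.trace_mul_comm, ← mul_assoc, Units.inv_mul, one_mul]
    have hinv : (A⁻¹ : GL2Z).1.trace = -A.1.trace := by
      have hdet : (-1 : ℤ) • A.1.adjugate = (A⁻¹ : GL2Z).1 := by
        rw [Units.eq_inv_of_mul_eq_one_right (u := A) (a := (-1 : ℤ) • A.1.adjugate)]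
        rw [smul_mul_assoc, Matrix.adjugate_mul, hd, smul_smul]
        simp
      rw [← hdet, Matrix.adjugate_fin_two, Matrix.trace_smul, Matrix.trace_fin_two,
        Matrix.trace_fin_two]
      simp [add_comm]
    rw [htr] at hinv
    change A.1.trace = 0
    omega

/-- Cayley–Hamilton for a matrix of determinant one acting on `ℤ × ℤ`. -/
lemma mulVec2_mulVec2_add {M : Matrix (Fin 2) (Fin 2) ℤ} (hM : M.det = 1) (v : ℤ × ℤ) :
    mulVec2 M (mulVec2 M v) + v = M.trace • mulVec2 M v := by
  rw [Matrix.det_fin_two] at hM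
  rw [Matrix.trace_fin_two]
  apply Prod.ext <;> simp only [mulVec2, Prod.fst_add, Prod.snd_add, Prod.smul_fst,
    Prod.smul_snd, smul_eq_mul]
  · linear_combination (-v.1) * hM
  · linear_combination (-v.2) * hM

/-- Every homomorphism `E_A → ℤ` kills the canonical `ℤ × ℤ`. -/
lemma EA.map_inl_eq_one {A : GL2Z} (hd : (A : Matrix (Fin 2) (Fin 2) ℤ).det = 1)
    (ht : (A : Matrix (Fin 2) (Fin 2) ℤ).trace ≠ 2) (f : EA A →* Multiplicative ℤ)
    (v : Multiplicative (ℤ × ℤ)) : f (inl v) = 1 := by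
  have hinv (w : Multiplicative (ℤ × ℤ)) : f (inl (glMulAut A w)) = f (inl w) := by
    have h1 : EAphi A (ofAdd 1) w = glMulAut A w := by
      rw [EAphi_apply]; simp
    rw [← h1, inl_aut, map_mul, map_mul, map_inv, mul_comm (f _), mul_assoc]
    simp
  have hCH : glMulAut A (glMulAut A v) * v = glMulAut A v ^ A.1.trace :=
    congrArg ofAdd (mulVec2_mulVec2_add hd v.toAdd)
  have := congrArg (fun w => (f (inl w)).toAdd) hCH
  simp only [map_mul, map_zpow, hinv, toAdd_mul, toAdd_zpow, smul_eq_mul] at this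
  have h0 : (A.1.trace - 2) * (f (inl v)).toAdd = 0 := by linear_combination -this
  exact toAdd_eq_zero.1 ((mul_eq_zero.1 h0).resolve_left (sub_ne_zero.2 ht))

/-- An automorphism of `E_A` acts on the quotient
`ℤ` by the identity or by inversion. -/
lemma EA.rightHom_apply_eq_or {A : GL2Z} (hd : (A : Matrix (Fin 2) (Fin 2) ℤ).det = 1)
    (ht : (A : Matrix (Fin 2) (Fin 2) ℤ).trace ≠ 2) (e : MulAut (EA A)) :
    (∀ g, rightHom (e g) = rightHom g) ∨ ∀ g, rightHom (e g) = (rightHom g)⁻¹ := by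
  let f : EA A →* Multiplicative ℤ := rightHom.comp e.toMonoidHom
  have hf (g : EA A) : f g = f (inr (ofAdd 1)) ^ (rightHom g).toAdd := by
    conv_lhs => rw [← inl_left_mul_inr_right g, map_mul, EA.map_inl_eq_one hd ht f, one_mul]
    rw [← map_zpow, ← map_zpow]
    congr 2
    change g.right = ofAdd (1 : ℤ) ^ g.right.toAdd
    rw [← ofAdd_zsmul, smul_eq_mul, mul_one, ofAdd_toAdd]
  have hsurj : Function.Surjective f := rightHom_surjective.comp e.surjective
  obtain ⟨g, hg⟩ := hsurj (ofAdd 1)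
  have hu : (rightHom g).toAdd * (f (inr (ofAdd 1))).toAdd = 1 := by
    have := congrArg toAdd ((hf g).symm.trans hg)
    simpa using this
  rcases Int.isUnit_iff.1 (IsUnit.of_mul_eq_one_right _ hu) with h | h
  · left
    intro g
    refine (hf g).trans (toAdd.injective ?_)
    simp [h]
  · right
    intro g
    refine (hf g).trans (toAdd.injective ?_)
    simp [h]

lemma mem_Aut₀_of_rightHom {A : GL2Z} {e : MulAut (EA A)}
    (h : ∀ g, rightHom (e g) = rightHom g) : e ∈ Aut₀ A := by
  refine ⟨?_, h⟩
  have hE : EAsub A = (rightHom : EA A →* Multiplicative ℤ).ker := range_inl_eq_ker_rightHom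
  rw [hE]
  ext x
  rw [Subgroup.mem_map]
  constructor
  · rintro ⟨y, hy, rfl⟩
    exact (h y).trans hy
  · intro hx
    refine ⟨e.symm x, ?_, e.apply_symm_apply x⟩
    rw [MonoidHom.mem_ker, ← h, e.apply_symm_apply]
    exact hx

/-- The involution in `GL(2,ℤ)` with matrix `[[1, c], [0, -1]]`. -/
def upperInvolution (c : ℤ) : GL2Z where
  val := !![1, c; 0, -1]
  inv := !![1, c; 0, -1]
  val_inv := by simp [Matrix.one_fin_two]
  inv_val := by simp [Matrix.one_fin_two]

lemma upperInvolution_mul_self (c : ℤ) : upperInvolution c * upperInvolution c = 1 :=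
  Units.ext (upperInvolution c).val_inv

lemma upperInvolution_conj {C : GL2Z} (hd : C.1.det = 1) {c : ℤ}
    (hc : C.1 1 1 = C.1 0 0 + c * C.1 1 0) :
    upperInvolution c * C * (upperInvolution c)⁻¹ = C⁻¹ := by
  refine eq_inv_of_mul_eq_one_left (Units.ext ?_)
  rw [Matrix.det_fin_two] at hd
  change !![1, c; 0, -1] * C.1 * !![1, c; 0, -1] * C.1 = 1
  rw [Matrix.eta_fin_two C.1, Matrix.one_fin_two]
  simp only [Matrix.mul_fin_two]
  ext i j
  fin_cases i <;> fin_cases j <;> simp only [Matrix.of_apply, Matrix.cons_val', Matrix.cons_val,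
    Fin.zero_eta, Fin.mk_one]
  · linear_combination hd - (C.1 0 0 + c * C.1 1 0) * hc
  · linear_combination -(C.1 0 1 + c * C.1 1 1) * hc
  · linear_combination C.1 1 0 * hc
  · linear_combination hd + C.1 1 1 * hc

/-- If `A` is Anosov, `R(A) ≠ ∅`, and `A` is conjugate to a matrix with equal
diagonal entries or to a matrix `[[x, y], [w - x, w]]`, then the extension
`1 → Aut₀(E_A) → Aut(E_A) → ℤ/2 → 1` splits: some `ξ ∉ Aut₀(E_A)` satisfies `ξ² = 1`, and
`Aut(E_A)` is a semidirect product `Aut₀(E_A) ⋊ ℤ/2`. -/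
theorem stmt5 (A : GL2Z) (hA : IsAnosov A)
    (hR : {B : GL2Z | B * A * B⁻¹ = A⁻¹}.Nonempty)
    (hform : (∃ P : GL2Z, ((P * A * P⁻¹ : GL2Z) : Matrix (Fin 2) (Fin 2) ℤ) 0 0 =
        ((P * A * P⁻¹ : GL2Z) : Matrix (Fin 2) (Fin 2) ℤ) 1 1) ∨
      (∃ P : GL2Z, ((P * A * P⁻¹ : GL2Z) : Matrix (Fin 2) (Fin 2) ℤ) 1 0 =
        ((P * A * P⁻¹ : GL2Z) : Matrix (Fin 2) (Fin 2) ℤ) 1 1 -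
          ((P * A * P⁻¹ : GL2Z) : Matrix (Fin 2) (Fin 2) ℤ) 0 0)) :
    (∃ ξ : MulAut (EA A), ξ ∉ Aut₀ A ∧ ξ * ξ = 1) ∧
    ∃ ψ : Multiplicative (ZMod 2) →* MulAut (Aut₀ A),
      Nonempty ((MulAut (EA A)) ≃* ((Aut₀ A) ⋊[ψ] Multiplicative (ZMod 2))) := by
  obtain ⟨B₀, hB₀⟩ := hR
  have hd := hA.det_eq_one hB₀
  have ht : A.1.trace ≠ 2 := fun h => hA (Or.inl ⟨hd, by rw [h]; decide⟩)
  have hconj : ∃ P : GL2Z, ∃ c : ℤ, (P * A * P⁻¹).1 1 1 =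
      (P * A * P⁻¹).1 0 0 + c * (P * A * P⁻¹).1 1 0 := by
    rcases hform with ⟨P, hP⟩ | ⟨P, hP⟩
    · exact ⟨P, 0, by linear_combination -hP⟩
    · exact ⟨P, 1, by linear_combination -hP⟩
  obtain ⟨P, c, hP⟩ := hconj
  obtain ⟨B, hB, hB2⟩ : ∃ B : GL2Z, B * A * B⁻¹ = A⁻¹ ∧ B * B = 1 := by
    have hdP : (P * A * P⁻¹).1.det = 1 := by
      rw [Units.val_mul, Units.val_mul, Matrix.det_mul_comm, ← mul_assoc, Units.inv_mul, one_mul,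
        hd]
    have hS := upperInvolution_conj hdP hP
    have hS2 := upperInvolution_mul_self c
    refine ⟨P⁻¹ * upperInvolution c * P, ?_, ?_⟩
    · calc _ = P⁻¹ * (upperInvolution c * (P * A * P⁻¹) * (upperInvolution c)⁻¹) * P := by group
        _ = A⁻¹ := by rw [hS]; group
    · calc _ = P⁻¹ * (upperInvolution c * upperInvolution c) * P := by group
        _ = 1 := by rw [hS2]; group
  have hnot := reversal_notMem_Aut₀ hB
  have hsq := reversal_mul_self hB hB2
  refine ⟨⟨reversal hB, hnot, hsq⟩,
    (Aut₀ A).exists_mulEquiv_semidirectProduct_zmod_two hnot hsq fun e => ?_⟩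
  rcases EA.rightHom_apply_eq_or hd ht e with h | h
  · exact Or.inr (mem_Aut₀_of_rightHom h)
  · refine Or.inl (mem_Aut₀_of_rightHom fun g => ?_)
    rw [MulAut.mul_apply, rightHom_reversal, h, inv_inv]
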